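/- arXiv:1403.3621 — 4 statements merged into one kernel-verified Lean document; each statement's English description precedes it below -/
import Mathlib

section
/- Let K be a field and let P₁ Q₁ R₁ S and P₂ Q₂ R₂ S be quadrangles in the projective plane ℙ K (Fin 3 → K) sharing the vertex S, whose homologous sides through S coincide: S P₁ = S P₂, S Q₁ = S Q₂ and S R₁ = S R₂ as lines. Suppose the two quadrangles are perspective from a point O with O ≠ S. Then at most one of the pairs (P₁, P₂), (Q₁, Q₂), (R₁, R₂) has distinct entries; that is, none of the conjunctions (P₁ ≠ P₂ and Q₁ ≠ Q₂), (Q₁ ≠ Q₂ and R₁ ≠ R₂), (R₁ ≠ R₂ and P₁ ≠ P₂) holds. -/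
open Projectivization

/-- Three points of the projective plane are collinear if their representative
vectors are linearly dependent. -/
def Col (K : Type*) [Field K] (a b c : Projectivization K (Fin 3 → K)) : Prop :=
  ¬ Projectivization.Independent ![a, b, c]

/-- A quadrangle: four points, no three of which are collinear. -/
def IsQuadrangle (K : Type*) [Field K] (P Q R S : Projectivization K (Fin 3 → K)) : Prop :=
  ¬ Col K P Q R ∧ ¬ Col K P Q S ∧ ¬ Col K P R S ∧ ¬ Col K Q R S

/-- The line through two points, as a submodule of `K³`. -/
def line {K : Type*} [Field K] (a b : Projectivization K (Fin 3 → K)) :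
    Submodule K (Fin 3 → K) :=
  a.submodule ⊔ b.submodule

theorem aux_mem {K : Type*} [Field K] (P₁ P₂ S O : Projectivization K (Fin 3 → K))
    (hl : line S P₁ = line S P₂) (hc : Col K O P₁ P₂) (hne : P₁ ≠ P₂) :
    ∃ a b : K, a • S.rep + b • P₁.rep = O.rep := by
  have hli : LinearIndependent K ![P₁.rep, P₂.rep] := by
    have := (independent_pair_iff_ne P₁ P₂).2 hne
    rw [independent_iff] at this
    have e : (![P₁.rep, P₂.rep] : Fin 2 → Fin 3 → K) = Projectivization.rep ∘ ![P₁, P₂] := by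
      funext i
      fin_cases i <;> rfl
    rw [e]
    exact this
  have hmem : O.rep ∈ Submodule.span K (Set.range ![P₁.rep, P₂.rep]) := by
    by_contra hn
    apply hc
    rw [independent_iff]
    have := linearIndependent_finCons.2 ⟨hli, hn⟩
    convert this using 1
    ext i
    fin_cases i <;> rfl
  have h1 : P₁.rep ∈ line S P₁ := by
    apply Submodule.mem_sup_right
    rw [submodule_eq]
    exact Submodule.mem_span_singleton_self _
  have h2 : P₂.rep ∈ line S P₁ := by
    rw [hl]
    apply Submodule.mem_sup_right
    rw [submodule_eq]
    exact Submodule.mem_span_singleton_self _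
  have h3 : O.rep ∈ line S P₁ := by
    refine (Submodule.span_le.2 ?_) hmem
    rintro _ ⟨i, rfl⟩
    fin_cases i
    · exact h1
    · exact h2
  rw [line, submodule_eq, submodule_eq, ← Submodule.span_union] at h3
  exact Submodule.mem_span_pair.1 h3

theorem aux_pair {K : Type*} [Field K] (P₁ Q₁ P₂ Q₂ S O : Projectivization K (Fin 3 → K))
    (hn : ¬ Col K P₁ Q₁ S) (hSP : line S P₁ = line S P₂) (hSQ : line S Q₁ = line S Q₂)
    (hP : Col K O P₁ P₂) (hQ : Col K O Q₁ Q₂) (hOS : O ≠ S) :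
    ¬ (P₁ ≠ P₂ ∧ Q₁ ≠ Q₂) := by
  rintro ⟨hp, hq⟩
  obtain ⟨a, b, h1⟩ := aux_mem P₁ P₂ S O hSP hP hp
  obtain ⟨c, d, h2⟩ := aux_mem Q₁ Q₂ S O hSQ hQ hq
  rw [Col, not_not, independent_iff, Fintype.linearIndependent_iff] at hn
  have hb := hn ![b, -d, a - c] (by
    simp only [Fin.sum_univ_three, Function.comp_apply, Matrix.cons_val]
    rw [neg_smul, sub_smul]
    linear_combination (exp := 1) h1 - h2) 0
  simp only [Matrix.cons_val] at hb
  rw [hb, zero_smul, add_zero] at h1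
  apply hOS
  rw [← mk_rep O, ← mk_rep S, mk_eq_mk_iff']
  exact ⟨a, h1⟩

theorem at_most_one_distinct_pair_of_shared_vertex
    {K : Type*} [Field K]
    (P₁ Q₁ R₁ P₂ Q₂ R₂ S O : Projectivization K (Fin 3 → K))
    (hq1 : IsQuadrangle K P₁ Q₁ R₁ S)
    (hq2 : IsQuadrangle K P₂ Q₂ R₂ S)
    (hSP : line S P₁ = line S P₂)
    (hSQ : line S Q₁ = line S Q₂)
    (hSR : line S R₁ = line S R₂)
    (hperspP : Col K O P₁ P₂) (hperspQ : Col K O Q₁ Q₂)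
    (hperspR : Col K O R₁ R₂) (hperspS : Col K O S S)
    (hOS : O ≠ S) :
    ¬ (P₁ ≠ P₂ ∧ Q₁ ≠ Q₂) ∧ ¬ (Q₁ ≠ Q₂ ∧ R₁ ≠ R₂) ∧ ¬ (R₁ ≠ R₂ ∧ P₁ ≠ P₂) := by
  refine ⟨aux_pair P₁ Q₁ P₂ Q₂ S O hq1.2.1 hSP hSQ hperspP hperspQ hOS,
    aux_pair Q₁ R₁ Q₂ R₂ S O hq1.2.2.2 hSQ hSR hperspQ hperspR hOS, fun h => ?_⟩
  exact aux_pair P₁ R₁ P₂ R₂ S O hq1.2.2.1 hSP hSR hperspP hperspR hOS h.symm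
end

section
/- Let K be a field and let P₁ Q₁ R₁ S₁ and P₂ Q₂ R₂ S₂ be quadrangles in the projective plane ℙ K (Fin 3 → K), perspective from a point O that is distinct from all eight vertices. Suppose that in each pair of opposite sides at least one side equals its homologue as a line: (S₁P₁ = S₂P₂ or Q₁R₁ = Q₂R₂), (S₁Q₁ = S₂Q₂ or R₁P₁ = R₂P₂), and (S₁R₁ = S₂R₂ or P₁Q₁ = P₂Q₂). Then at most one of the four homologous vertex pairs (P₁, P₂), (Q₁, Q₂), (R₁, R₂), (S₁, S₂) has distinct entries. -/
open Projectivization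

theorem aux_fix {K : Type*} [Field K] {O A₁ B₁ A₂ B₂ : Projectivization K (Fin 3 → K)}
    (hA : Col K O A₁ A₂) (hB : Col K O B₁ B₂) (h : line A₁ B₁ = line A₂ B₂) :
    O.rep ∈ line A₁ B₁ ∨ (A₁ = A₂ ∧ B₁ = B₂) := by
  have key : ∀ X Y : Projectivization K (Fin 3 → K), Col K O X Y → X ≠ Y →
      O.rep ∈ X.submodule ⊔ Y.submodule := by
    intro X Y hc hne
    by_contra hO
    apply hc
    rw [Projectivization.independent_iff]
    have h2 : LinearIndependent K ![X.rep, Y.rep] := by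
      have := Projectivization.independent_iff.1 ((Projectivization.independent_pair_iff_ne _ _).2 hne)
      have e : Projectivization.rep ∘ ![X, Y] = ![X.rep, Y.rep] := by
        funext i; fin_cases i <;> rfl
      rw [e] at this; exact this
    have h3 : LinearIndependent K ![O.rep, X.rep, Y.rep] := by
      refine linearIndependent_finCons.2 ⟨h2, ?_⟩
      rw [Projectivization.submodule_eq, Projectivization.submodule_eq,
        ← Submodule.span_union] at hO
      convert hO using 3
      rw [Matrix.range_cons, Matrix.range_cons, Matrix.range_empty, Set.union_empty]
    have e : Projectivization.rep ∘ ![O, X, Y] = ![O.rep, X.rep, Y.rep] := by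
      funext i; fin_cases i <;> rfl
    rw [e]; exact h3
  by_cases ha : A₁ = A₂
  · by_cases hb : B₁ = B₂
    · exact Or.inr ⟨ha, hb⟩
    · left
      refine (sup_le ?_ ?_ : B₁.submodule ⊔ B₂.submodule ≤ line A₁ B₁) (key _ _ hB hb)
      · exact le_sup_right
      · rw [h]; exact le_sup_right
  · left
    refine (sup_le ?_ ?_ : A₁.submodule ⊔ A₂.submodule ≤ line A₁ B₁) (key _ _ hA ha)
    · exact le_sup_left
    · rw [h]; exact le_sup_left

theorem aux_excl {K : Type*} [Field K] {O A B C : Projectivization K (Fin 3 → K)}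
    (hn : LinearIndependent K ![A.rep, B.rep, C.rep]) (hO : O ≠ A)
    (h1 : O.rep ∈ line A B) (h2 : O.rep ∈ line A C) : False := by
  unfold line at h1 h2
  rw [Projectivization.submodule_eq, Projectivization.submodule_eq,
    ← Submodule.span_union, Set.singleton_union, Submodule.mem_span_pair] at h1 h2
  obtain ⟨a, b, h1⟩ := h1
  obtain ⟨c, d, h2⟩ := h2
  have hb : b = 0 := by
    have := Fintype.linearIndependent_iff.1 hn ![a - c, b, -d] (by
      simp only [Fin.sum_univ_three, Matrix.cons_val]
      have := h1.trans h2.symm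
      linear_combination (norm := module) this) 1
    simpa using this
  subst hb
  apply hO
  rw [← O.mk_rep, ← A.mk_rep, Projectivization.mk_eq_mk_iff']
  exact ⟨a, by simpa using h1⟩

theorem aux_li {K : Type*} [Field K] {A B C : Projectivization K (Fin 3 → K)}
    (h : ¬ Col K A B C) : LinearIndependent K ![A.rep, B.rep, C.rep] := by
  have := Projectivization.independent_iff.1 (not_not.1 h)
  have e : Projectivization.rep ∘ ![A, B, C] = ![A.rep, B.rep, C.rep] := by
    funext i; fin_cases i <;> rfl
  rw [e] at this; exact this

theorem aux_tri {K : Type*} [Field K] {O A B C : Projectivization K (Fin 3 → K)}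
    (h : ¬ Col K A B C) (hA : O ≠ A) (hB : O ≠ B) (hC : O ≠ C) :
    ¬ (O.rep ∈ line A B ∧ O.rep ∈ line A C) ∧ ¬ (O.rep ∈ line A B ∧ O.rep ∈ line B C) ∧
    ¬ (O.rep ∈ line A C ∧ O.rep ∈ line B C) := by
  have hl := aux_li h
  have comm : ∀ X Y : Projectivization K (Fin 3 → K), line X Y = line Y X :=
    fun X Y => sup_comm _ _
  refine ⟨fun h => aux_excl hl hA h.1 h.2, fun h => ?_, fun h => ?_⟩
  · refine aux_excl (A := B) (B := A) (C := C) ?_ hB (comm A B ▸ h.1) h.2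
    convert hl.comp ![1, 0, 2] (by decide) using 1
    ext i; fin_cases i <;> rfl
  · refine aux_excl (A := C) (B := A) (C := B) ?_ hC (comm A C ▸ h.1) (comm B C ▸ h.2)
    convert hl.comp ![2, 0, 1] (by decide) using 1
    ext i; fin_cases i <;> rfl

theorem at_most_one_distinct_vertex_pair
    {K : Type*} [Field K]
    (P₁ Q₁ R₁ S₁ P₂ Q₂ R₂ S₂ O : Projectivization K (Fin 3 → K))
    (hq1 : IsQuadrangle K P₁ Q₁ R₁ S₁)
    (hq2 : IsQuadrangle K P₂ Q₂ R₂ S₂)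
    (hperspP : Col K O P₁ P₂) (hperspQ : Col K O Q₁ Q₂)
    (hperspR : Col K O R₁ R₂) (hperspS : Col K O S₁ S₂)
    (hOP₁ : O ≠ P₁) (hOQ₁ : O ≠ Q₁) (hOR₁ : O ≠ R₁) (hOS₁ : O ≠ S₁)
    (hOP₂ : O ≠ P₂) (hOQ₂ : O ≠ Q₂) (hOR₂ : O ≠ R₂) (hOS₂ : O ≠ S₂)
    (h1 : line S₁ P₁ = line S₂ P₂ ∨ line Q₁ R₁ = line Q₂ R₂)
    (h2 : line S₁ Q₁ = line S₂ Q₂ ∨ line R₁ P₁ = line R₂ P₂)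
    (h3 : line S₁ R₁ = line S₂ R₂ ∨ line P₁ Q₁ = line P₂ Q₂) :
    ¬ (P₁ ≠ P₂ ∧ Q₁ ≠ Q₂) ∧ ¬ (P₁ ≠ P₂ ∧ R₁ ≠ R₂) ∧ ¬ (P₁ ≠ P₂ ∧ S₁ ≠ S₂) ∧
    ¬ (Q₁ ≠ Q₂ ∧ R₁ ≠ R₂) ∧ ¬ (Q₁ ≠ Q₂ ∧ S₁ ≠ S₂) ∧ ¬ (R₁ ≠ R₂ ∧ S₁ ≠ S₂) := by
  obtain ⟨a, b, c, d⟩ := hq1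
  have comm : ∀ X Y : Projectivization K (Fin 3 → K), line X Y = line Y X :=
    fun X Y => sup_comm _ _
  rw [comm S₁ P₁, comm S₂ P₂] at h1
  rw [comm S₁ Q₁, comm S₂ Q₂, comm R₁ P₁, comm R₂ P₂] at h2
  rw [comm S₁ R₁, comm S₂ R₂] at h3
  have h1' := h1.imp (aux_fix hperspP hperspS) (aux_fix hperspQ hperspR)
  have h2' := h2.imp (aux_fix hperspQ hperspS) (aux_fix hperspP hperspR)
  have h3' := h3.imp (aux_fix hperspR hperspS) (aux_fix hperspP hperspQ)
  have ta := aux_tri a hOP₁ hOQ₁ hOR₁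
  have tb := aux_tri b hOP₁ hOQ₁ hOS₁
  have tc := aux_tri c hOP₁ hOR₁ hOS₁
  have td := aux_tri d hOQ₁ hOR₁ hOS₁
  clear hq2 hperspP hperspQ hperspR hperspS h1 h2 h3 a b c d comm hOP₁ hOQ₁ hOR₁ hOS₁ hOP₂ hOQ₂ hOR₂ hOS₂
  grind
end

section
/- Let K be a field and let P Q R S₁ and P Q R S₂ be quadrangles in the projective plane ℙ K (Fin 3 → K) sharing the three vertices P, Q, R, perspective from a point O that is distinct from P, Q and R. Suppose their diagonal triangles are perspective from O, in the sense that: for all points A₁ collinear with S₁, P and with Q, R and A₂ collinear with S₂, P and with Q, R, the triple (O, A₁, A₂) is collinear; for all B₁ collinear with S₁, Q and with R, P and B₂ collinear with S₂, Q and with R, P, the triple (O, B₁, B₂) is collinear; and for all C₁ collinear with S₁, R and with P, Q and C₂ collinear with S₂, R and with P, Q, the triple (O, C₁, C₂) is collinear. Then S₁ = S₂. -/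
open Projectivization

/-- Explicit determinant. -/
def D3 {K : Type*} [Field K] (u v w : Fin 3 → K) : K :=
  u 0 * v 1 * w 2 - u 0 * v 2 * w 1 - u 1 * v 0 * w 2 + u 1 * v 2 * w 0
    + u 2 * v 0 * w 1 - u 2 * v 1 * w 0

lemma col_iff {K : Type*} [Field K] (u v w : Fin 3 → K) (hu : u ≠ 0) (hv : v ≠ 0) (hw : w ≠ 0) :
    Col K (Projectivization.mk K u hu) (Projectivization.mk K v hv) (Projectivization.mk K w hw)
      ↔ D3 u v w = 0 := by
  have h1 : (![Projectivization.mk K u hu, Projectivization.mk K v hv,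
      Projectivization.mk K w hw] : Fin 3 → _)
      = fun i => Projectivization.mk K ((![u, v, w] : Fin 3 → Fin 3 → K) i)
        (by fin_cases i <;> simpa) := by
    funext i; fin_cases i <;> rfl
  have h2 : LinearIndependent K (![u, v, w] : Fin 3 → Fin 3 → K) ↔ D3 u v w ≠ 0 := by
    have h3 : D3 u v w = Matrix.det (Matrix.of ![u, v, w]) := by
      rw [Matrix.det_fin_three]
      simp [D3]
    rw [h3, ← isUnit_iff_ne_zero, ← Matrix.isUnit_iff_isUnit_det,
      ← Matrix.linearIndependent_rows_iff_isUnit]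
    rfl
  unfold Col
  rw [not_iff_comm, ← ne_eq, ← h2, h1]
  constructor
  · intro h
    exact Projectivization.Independent.mk _ _ h
  · intro h
    rw [Projectivization.independent_iff] at h
    choose a ha using fun i : Fin 3 => Projectivization.exists_smul_eq_mk_rep K
      ((![u, v, w] : Fin 3 → Fin 3 → K) i) (by fin_cases i <;> simpa)
    convert! h.units_smul a⁻¹ using 1
    ext i
    simp [← ha]

lemma exists_coef {K : Type*} [Field K] (p q r s : Fin 3 → K) (h : D3 p q r ≠ 0) :
    ∃ a b c : K, s = a • p + b • q + c • r := by
  refine ⟨D3 s q r / D3 p q r, D3 p s r / D3 p q r, D3 p q s / D3 p q r, ?_⟩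
  ext i
  simp only [Pi.add_apply, Pi.smul_apply, smul_eq_mul]
  field_simp
  fin_cases i <;> simp [D3] <;> ring

lemma prop_of {K : Type*} [Field K] {a b c d e f : K} (hc : c ≠ 0) (hf : f ≠ 0)
    (h1 : b * f = c * e) (h2 : a * f = c * d) : ∃ t : K, t * d = a ∧ t * e = b ∧ t * f = c := by
  refine ⟨c / f, ?_, ?_, ?_⟩ <;> field_simp
  · rw [← h2, mul_comm]
  · rw [← h1, mul_comm]

theorem shared_triangle_diagonal_perspective_forces_equal
    {K : Type*} [Field K]
    (P Q R S₁ S₂ O : Projectivization K (Fin 3 → K))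
    (hq1 : IsQuadrangle K P Q R S₁)
    (hq2 : IsQuadrangle K P Q R S₂)
    (hperspP : Col K O P P) (hperspQ : Col K O Q Q)
    (hperspR : Col K O R R) (hperspS : Col K O S₁ S₂)
    (hOP : O ≠ P) (hOQ : O ≠ Q) (hOR : O ≠ R)
    (hA : ∀ A₁ A₂ : Projectivization K (Fin 3 → K),
      Col K S₁ P A₁ → Col K Q R A₁ → Col K S₂ P A₂ → Col K Q R A₂ →
      Col K O A₁ A₂)
    (hB : ∀ B₁ B₂ : Projectivization K (Fin 3 → K),
      Col K S₁ Q B₁ → Col K R P B₁ → Col K S₂ Q B₂ → Col K R P B₂ →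
      Col K O B₁ B₂)
    (hC : ∀ C₁ C₂ : Projectivization K (Fin 3 → K),
      Col K S₁ R C₁ → Col K P Q C₁ → Col K S₂ R C₂ → Col K P Q C₂ →
      Col K O C₁ C₂) :
    S₁ = S₂ := by
  induction P using Projectivization.ind with | h p hp => ?_
  induction Q using Projectivization.ind with | h q hq => ?_
  induction R using Projectivization.ind with | h r hr => ?_
  induction S₁ using Projectivization.ind with | h s hs => ?_
  induction S₂ using Projectivization.ind with | h t ht => ?_
  induction O using Projectivization.ind with | h o ho => ?_
  clear hperspP hperspQ hperspR hperspS
  simp only [IsQuadrangle, col_iff] at hq1 hq2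
  obtain ⟨hD, h1, h2, h3⟩ := hq1
  obtain ⟨-, k1, k2, k3⟩ := hq2
  obtain ⟨a, b, c, es⟩ := exists_coef p q r s hD
  obtain ⟨d, e, f, et⟩ := exists_coef p q r t hD
  obtain ⟨x, y, z, eo⟩ := exists_coef p q r o hD
  have nz : ∀ (a b c : K), (a ≠ 0 ∨ b ≠ 0 ∨ c ≠ 0) → a • p + b • q + c • r ≠ 0 := by
    intro a b c h h0
    have e1 : D3 (a • p + b • q + c • r) q r = a * D3 p q r := by simp [D3]; ring
    have e2 : D3 p (a • p + b • q + c • r) r = b * D3 p q r := by simp [D3]; ring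
    have e3 : D3 p q (a • p + b • q + c • r) = c * D3 p q r := by simp [D3]; ring
    rw [h0] at e1 e2 e3
    simp [D3] at e1 e2 e3
    simp only [D3] at hD
    grind
  have dc : ∀ a b c : K, D3 p q (a • p + b • q + c • r) = c * D3 p q r := by
    intros; simp [D3]; ring
  have db : ∀ a b c : K, D3 p r (a • p + b • q + c • r) = -b * D3 p q r := by
    intros; simp [D3]; ring
  have da : ∀ a b c : K, D3 q r (a • p + b • q + c • r) = a * D3 p q r := by
    intros; simp [D3]; ring
  rw [es, dc] at h1
  rw [es, db] at h2
  rw [es, da] at h3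
  rw [et, dc] at k1
  rw [et, db] at k2
  rw [et, da] at k3
  have hc := left_ne_zero_of_mul h1
  have hb := neg_ne_zero.mp (left_ne_zero_of_mul h2)
  have ha := left_ne_zero_of_mul h3
  have hf := left_ne_zero_of_mul k1
  have he := neg_ne_zero.mp (left_ne_zero_of_mul k2)
  have hd := left_ne_zero_of_mul k3
  have A := hA (Projectivization.mk K _ (nz 0 b c (by simp [hb])))
    (Projectivization.mk K _ (nz 0 e f (by simp [he])))
  have B := hB (Projectivization.mk K _ (nz a 0 c (by simp [ha])))
    (Projectivization.mk K _ (nz d 0 f (by simp [hd])))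
  have C := hC (Projectivization.mk K _ (nz a b 0 (by simp [ha])))
    (Projectivization.mk K _ (nz d e 0 (by simp [hd])))
  clear hA hB hC
  simp only [col_iff] at A B C
  replace A := A (by rw [es]; simp [D3]; ring) (by simp [D3]; ring)
    (by rw [et]; simp [D3]; ring) (by simp [D3]; ring)
  replace B := B (by rw [es]; simp [D3]; ring) (by simp [D3]; ring)
    (by rw [et]; simp [D3]; ring) (by simp [D3]; ring)
  replace C := C (by rw [es]; simp [D3]; ring) (by simp [D3]; ring)
    (by rw [et]; simp [D3]; ring) (by simp [D3]; ring)
  have A' : x * (b * f - c * e) = 0 := by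
    apply (mul_left_inj' hD).mp; rw [zero_mul]
    rw [← A, eo]; simp [D3]; ring
  have B' : y * (a * f - c * d) = 0 := by
    apply (mul_left_inj' hD).mp; rw [zero_mul]
    rw [← neg_eq_zero.mpr B, eo]; simp [D3]; ring
  have C' : z * (a * e - b * d) = 0 := by
    apply (mul_left_inj' hD).mp; rw [zero_mul]
    rw [← C, eo]; simp [D3]; ring
  rw [ne_eq, Projectivization.mk_eq_mk_iff'] at hOP hOQ hOR
  have n1 : ¬ (y = 0 ∧ z = 0) := by
    rintro ⟨rfl, rfl⟩; exact hOP ⟨x, by simp [eo]⟩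
  have n2 : ¬ (x = 0 ∧ z = 0) := by
    rintro ⟨rfl, rfl⟩; exact hOQ ⟨y, by simp [eo]⟩
  have n3 : ¬ (x = 0 ∧ y = 0) := by
    rintro ⟨rfl, rfl⟩; exact hOR ⟨z, by simp [eo]⟩
  have key : b * f = c * e ∧ a * f = c * d := by
    clear nz dc db da A B C
    simp only [mul_eq_zero, sub_eq_zero] at A' B' C'
    rcases A' with A' | A' <;> rcases B' with B' | B' <;> rcases C' with C' | C'
    · exact absurd ⟨A', B'⟩ n3
    · exact absurd ⟨A', B'⟩ n3
    · exact absurd ⟨A', C'⟩ n2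
    · refine ⟨mul_left_cancel₀ hd ?_, B'⟩
      linear_combination e * B' - f * C'
    · exact absurd ⟨B', C'⟩ n1
    · refine ⟨A', mul_left_cancel₀ he ?_⟩
      linear_combination d * A' + f * C'
    · exact ⟨A', B'⟩
    · exact ⟨A', B'⟩
  obtain ⟨m, m1, m2, m3⟩ := prop_of hc hf key.1 key.2
  rw [Projectivization.mk_eq_mk_iff']
  refine ⟨m, ?_⟩
  rw [es, et, ← m1, ← m2, ← m3]
  simp [smul_smul]
end

section
/- Let K be a field and let P₁ Q₁ R₁ S₁ and P₂ Q₂ R₂ S₂ be quadrangles in the projective plane ℙ K (Fin 3 → K), perspective from a point O. Assume general position: all homologous vertex pairs are distinct (P₁ ≠ P₂, Q₁ ≠ Q₂, R₁ ≠ R₂, S₁ ≠ S₂) and all six homologous side lines are distinct (Q₁R₁ ≠ Q₂R₂, R₁P₁ ≠ R₂P₂, P₁Q₁ ≠ P₂Q₂, S₁P₁ ≠ S₂P₂, S₁Q₁ ≠ S₂Q₂, S₁R₁ ≠ S₂R₂ as lines). Suppose moreover that for some points C₁ collinear with S₁, R₁ and with P₁, Q₁ and C₂ collinear with S₂, R₂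 and with P₂, Q₂, the triple (O, C₁, C₂) is collinear. Then the six intersection points of homologous sides lie on one line: there exists a rank-2 subspace ℓ of K³ such that every point lying on both Q₁R₁ and Q₂R₂, every point lying on both R₁P₁ and R₂P₂, every point lying on both P₁Q₁ and P₂Q₂, every point lying on both S₁P₁ and S₂P₂, every point lying on both S₁Q₁ and S₂Q₂, and every point lying on both S₁R₁ and S₂R₂, lies on ℓ (a point x lies on ℓ if x.submodule ≤ ℓ). -/
open Projectivization

section aux
variable {K : Type*} [Field K]

theorem aux_inter (L M : Submodule K (Fin 3 → K)) (hL : Module.finrank K L = 2)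
    (hM : Module.finrank K M = 2) (hne : L ≠ M) (x y : Fin 3 → K)
    (hxL : x ∈ L) (hxM : x ∈ M) (hyL : y ∈ L) (hyM : y ∈ M) (hx : x ≠ 0) :
    ∃ c : K, y = c • x := by
  have h1 : Module.finrank K ↥(L ⊓ M) ≤ 1 := by
    by_contra h
    have e1 : L ⊓ M = L := Submodule.eq_of_le_of_finrank_le inf_le_left (by omega)
    have e2 : L ⊓ M = M := Submodule.eq_of_le_of_finrank_le inf_le_right (by omega)
    exact hne (e1.symm.trans e2)
  by_contra hc
  push Not at hc
  have hli : LinearIndependent K ![x, y] := by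
    rw [LinearIndependent.pair_iff' hx]
    intro a h
    exact hc a h.symm
  have h2 := finrank_span_eq_card hli
  have h3 : Submodule.span K (Set.range ![x, y]) ≤ L ⊓ M := by
    rw [Submodule.span_le]
    rintro _ ⟨i, rfl⟩
    fin_cases i
    · exact ⟨hxL, hxM⟩
    · exact ⟨hyL, hyM⟩
  have h4 := Submodule.finrank_mono h3
  simp at h2
  omega

theorem aux_mem_line (a b : Projectivization K (Fin 3 → K)) (x : Fin 3 → K) :
    x ∈ line a b ↔ ∃ s t : K, s • a.rep + t • b.rep = x := by
  rw [line, Projectivization.submodule_eq, Projectivization.submodule_eq,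
    ← Submodule.span_insert, Submodule.mem_span_pair]

theorem aux_le (x : Projectivization K (Fin 3 → K)) (L : Submodule K (Fin 3 → K)) :
    x.submodule ≤ L ↔ x.rep ∈ L := by
  rw [Projectivization.submodule_eq, Submodule.span_singleton_le_iff_mem]

theorem aux_pair_s9 (a b : Projectivization K (Fin 3 → K)) (h : a ≠ b) :
    LinearIndependent K ![a.rep, b.rep] := by
  rw [← Projectivization.independent_pair_iff_ne, Projectivization.independent_iff] at h
  have e : Projectivization.rep ∘ ![a, b] = ![a.rep, b.rep] := by
    ext i; fin_cases i <;> rfl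
  rwa [e] at h

theorem aux_pair2 (a b : Projectivization K (Fin 3 → K)) (h : a ≠ b) (s t : K)
    (h0 : s • a.rep + t • b.rep = 0) : s = 0 ∧ t = 0 := by
  have h2 := aux_pair_s9 a b h
  rw [LinearIndependent.pair_iff] at h2
  exact h2 s t h0

theorem aux_finrank_line (a b : Projectivization K (Fin 3 → K)) (h : a ≠ b) :
    Module.finrank K (line a b) = 2 := by
  have := finrank_span_eq_card (aux_pair_s9 a b h)
  rw [line, Projectivization.submodule_eq, Projectivization.submodule_eq,
    ← Submodule.span_insert]
  rw [Matrix.range_cons_cons_empty] at this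
  simpa using this

theorem aux_col (a b c : Projectivization K (Fin 3 → K)) :
    Col K a b c ↔ ¬ LinearIndependent K ![a.rep, b.rep, c.rep] := by
  rw [Col, Projectivization.independent_iff]
  have : Projectivization.rep ∘ ![a, b, c] = ![a.rep, b.rep, c.rep] := by
    ext i; fin_cases i <;> rfl
  rw [this]

theorem aux_col_mem (a b c : Projectivization K (Fin 3 → K)) (h : Col K a b c) (hbc : b ≠ c) :
    a.rep ∈ line b c := by
  rw [aux_col] at h
  by_contra h2
  apply h
  apply linearIndependent_finCons.2
  refine ⟨aux_pair_s9 b c hbc, ?_⟩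
  intro h3
  apply h2
  rw [line, Projectivization.submodule_eq, Projectivization.submodule_eq,
    ← Submodule.span_insert]
  rw [Matrix.range_cons_cons_empty] at h3
  exact h3

theorem aux_col_rot (a b c : Projectivization K (Fin 3 → K)) (h : Col K a b c) :
    Col K c a b := by
  rw [aux_col] at *
  intro h2
  apply h
  have := h2.comp ![1, 2, 0] (by decide)
  have e : ![c.rep, a.rep, b.rep] ∘ ![1, 2, 0] = ![a.rep, b.rep, c.rep] := by
    ext i; fin_cases i <;> rfl
  rwa [e] at this

theorem aux_ne (a b c : Projectivization K (Fin 3 → K)) (h : ¬ Col K a b c) :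
    a ≠ b ∧ a ≠ c ∧ b ≠ c := by
  rw [aux_col, not_not] at h
  have hi := h.injective
  refine ⟨?_, ?_, ?_⟩ <;> rintro rfl
  · exact absurd (@hi 0 1 rfl) (by decide)
  · exact absurd (@hi 0 2 rfl) (by decide)
  · exact absurd (@hi 1 2 rfl) (by decide)

theorem aux_tri_s9 (a b c : Projectivization K (Fin 3 → K)) (h : ¬ Col K a b c) (r s t : K)
    (h0 : r • a.rep + s • b.rep + t • c.rep = 0) : r = 0 ∧ s = 0 ∧ t = 0 := by
  rw [aux_col, not_not, Fintype.linearIndependent_iff] at h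
  have := h ![r, s, t] (by simpa [Fin.sum_univ_three] using h0)
  exact ⟨this 0, this 1, this 2⟩

/-- at most one coefficient vanishes -/
theorem aux_nz (O p q p' q' : Projectivization K (Fin 3 → K)) (hpq' : p' ≠ q') (a b c d : K)
    (h1 : a • p.rep + b • p'.rep = O.rep) (h2 : c • q.rep + d • q'.rep = O.rep)
    (ha : a = 0) (hc : c = 0) : False := by
  subst ha hc
  have h := aux_pair2 _ _ hpq' b (-d) (by
    linear_combination (norm := module) h1 - h2)
  rw [h.1] at h1
  exact O.rep_nonzero (by simpa using h1.symm)

/-- two perspective segments: the point `a p - c q` spans the intersection of the sides -/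
theorem aux_seg (O p q p' q' : Projectivization K (Fin 3 → K)) (hpq : p ≠ q) (hpq' : p' ≠ q')
    (hl : line p q ≠ line p' q') (a b c d : K)
    (h1 : a • p.rep + b • p'.rep = O.rep) (h2 : c • q.rep + d • q'.rep = O.rep) :
    a • p.rep - c • q.rep ≠ 0 ∧ ∀ y, y ∈ line p q → y ∈ line p' q' →
      ∃ k : K, y = k • (a • p.rep - c • q.rep) := by
  have hn : a • p.rep - c • q.rep ≠ 0 := by
    intro h
    have h := aux_pair2 _ _ hpq a (-c) (by
      linear_combination (norm := module) h)
    exact aux_nz O p q p' q' hpq' a b c d h1 h2 h.1 (neg_eq_zero.1 h.2)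
  refine ⟨hn, fun y hy hy' => ?_⟩
  refine aux_inter _ _ (aux_finrank_line _ _ hpq) (aux_finrank_line _ _ hpq') hl _ y ?_ ?_ hy hy' hn
  · rw [aux_mem_line]; exact ⟨a, -c, by module⟩
  · rw [aux_mem_line]; exact ⟨-b, d, by linear_combination (norm := module) h2 - h1⟩

theorem aux_self (a b : Projectivization K (Fin 3 → K)) : a.rep ∈ line a b ∧ b.rep ∈ line a b :=
  ⟨(aux_mem_line _ _ _).2 ⟨1, 0, by simp⟩, (aux_mem_line _ _ _).2 ⟨0, 1, by simp⟩⟩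

end aux

theorem homologous_side_intersections_collinear
    {K : Type*} [Field K]
    (P₁ Q₁ R₁ S₁ P₂ Q₂ R₂ S₂ O : Projectivization K (Fin 3 → K))
    (hq1 : IsQuadrangle K P₁ Q₁ R₁ S₁)
    (hq2 : IsQuadrangle K P₂ Q₂ R₂ S₂)
    (hperspP : Col K O P₁ P₂) (hperspQ : Col K O Q₁ Q₂)
    (hperspR : Col K O R₁ R₂) (hperspS : Col K O S₁ S₂)
    (hPP : P₁ ≠ P₂) (hQQ : Q₁ ≠ Q₂) (hRR : R₁ ≠ R₂) (hSS : S₁ ≠ S₂)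
    (hQR : line Q₁ R₁ ≠ line Q₂ R₂) (hRP : line R₁ P₁ ≠ line R₂ P₂)
    (hPQ : line P₁ Q₁ ≠ line P₂ Q₂) (hSP : line S₁ P₁ ≠ line S₂ P₂)
    (hSQ : line S₁ Q₁ ≠ line S₂ Q₂) (hSR : line S₁ R₁ ≠ line S₂ R₂)
    (C₁ C₂ : Projectivization K (Fin 3 → K))
    (hC₁SR : Col K S₁ R₁ C₁) (hC₁PQ : Col K P₁ Q₁ C₁)
    (hC₂SR : Col K S₂ R₂ C₂) (hC₂PQ : Col K P₂ Q₂ C₂)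
    (hOC : Col K O C₁ C₂) :
    ∃ ℓ : Submodule K (Fin 3 → K), Module.finrank K ℓ = 2 ∧
      (∀ x : Projectivization K (Fin 3 → K),
        x.submodule ≤ line Q₁ R₁ → x.submodule ≤ line Q₂ R₂ → x.submodule ≤ ℓ) ∧
      (∀ x : Projectivization K (Fin 3 → K),
        x.submodule ≤ line R₁ P₁ → x.submodule ≤ line R₂ P₂ → x.submodule ≤ ℓ) ∧
      (∀ x : Projectivization K (Fin 3 → K),
        x.submodule ≤ line P₁ Q₁ → x.submodule ≤ line P₂ Q₂ → x.submodule ≤ ℓ) ∧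
      (∀ x : Projectivization K (Fin 3 → K),
        x.submodule ≤ line S₁ P₁ → x.submodule ≤ line S₂ P₂ → x.submodule ≤ ℓ) ∧
      (∀ x : Projectivization K (Fin 3 → K),
        x.submodule ≤ line S₁ Q₁ → x.submodule ≤ line S₂ Q₂ → x.submodule ≤ ℓ) ∧
      (∀ x : Projectivization K (Fin 3 → K),
        x.submodule ≤ line S₁ R₁ → x.submodule ≤ line S₂ R₂ → x.submodule ≤ ℓ) := by
  obtain ⟨n1, n2, n3, n4⟩ := hq1
  obtain ⟨m1, m2, m3, m4⟩ := hq2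
  obtain ⟨nPQ, nPR, nQR⟩ := aux_ne _ _ _ n1
  obtain ⟨-, nPS, nQS⟩ := aux_ne _ _ _ n2
  obtain ⟨-, -, nRS⟩ := aux_ne _ _ _ n3
  obtain ⟨mPQ, mPR, mQR⟩ := aux_ne _ _ _ m1
  obtain ⟨-, mPS, mQS⟩ := aux_ne _ _ _ m2
  obtain ⟨-, -, mRS⟩ := aux_ne _ _ _ m3
  obtain ⟨p, p', hp⟩ := (aux_mem_line _ _ _).1 (aux_col_mem _ _ _ hperspP hPP)
  obtain ⟨q, q', hq⟩ := (aux_mem_line _ _ _).1 (aux_col_mem _ _ _ hperspQ hQQ)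
  obtain ⟨r, r', hr⟩ := (aux_mem_line _ _ _).1 (aux_col_mem _ _ _ hperspR hRR)
  obtain ⟨s, s', hs⟩ := (aux_mem_line _ _ _).1 (aux_col_mem _ _ _ hperspS hSS)
  have zPQ := aux_nz O P₁ Q₁ P₂ Q₂ mPQ p p' q q' hp hq
  have zPR := aux_nz O P₁ R₁ P₂ R₂ mPR p p' r r' hp hr
  have zQR := aux_nz O Q₁ R₁ Q₂ R₂ mQR q q' r r' hq hr
  have tri := aux_tri_s9 _ _ _ n1
  obtain ⟨xQR, iQR⟩ := aux_seg O Q₁ R₁ Q₂ R₂ nQR mQR hQR q q' r r' hq hr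
  obtain ⟨xRP, iRP⟩ := aux_seg O R₁ P₁ R₂ P₂ nPR.symm mPR.symm hRP r r' p p' hr hp
  obtain ⟨xPQ, iPQ⟩ := aux_seg O P₁ Q₁ P₂ Q₂ nPQ mPQ hPQ p p' q q' hp hq
  obtain ⟨xSP, iSP⟩ := aux_seg O S₁ P₁ S₂ P₂ nPS.symm mPS.symm hSP s s' p p' hs hp
  obtain ⟨xSQ, iSQ⟩ := aux_seg O S₁ Q₁ S₂ Q₂ nQS.symm mQS.symm hSQ s s' q q' hs hq
  obtain ⟨xSR, iSR⟩ := aux_seg O S₁ R₁ S₂ R₂ nRS.symm mRS.symm hSR s s' r r' hs hr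
  have c1SR := aux_col_mem _ _ _ (aux_col_rot _ _ _ hC₁SR) nRS.symm
  have c1PQ := aux_col_mem _ _ _ (aux_col_rot _ _ _ hC₁PQ) nPQ
  have c2SR := aux_col_mem _ _ _ (aux_col_rot _ _ _ hC₂SR) mRS.symm
  have c2PQ := aux_col_mem _ _ _ (aux_col_rot _ _ _ hC₂PQ) mPQ
  have key : ∃ u v : K, s • S₁.rep - r • R₁.rep =
      u • (p • P₁.rep - q • Q₁.rep) + v • (q • Q₁.rep - r • R₁.rep) := by
    by_cases hCC : C₁ = C₂
    · subst hCC
      obtain ⟨k, hk⟩ := iPQ _ c1PQ c2PQ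
      obtain ⟨k', hk'⟩ := iSR _ c1SR c2SR
      have hk0 : k' ≠ 0 := by
        rintro rfl
        exact C₁.rep_nonzero (by simpa using hk')
      refine ⟨k'⁻¹ * k, 0, ?_⟩
      rw [zero_smul, add_zero, mul_smul, ← hk, hk', smul_smul, inv_mul_cancel₀ hk0, one_smul]
    · obtain ⟨c, c', hc⟩ := (aux_mem_line _ _ _).1 (aux_col_mem _ _ _ hOC hCC)
      obtain ⟨k, hk⟩ := iPQ (p • P₁.rep - c • C₁.rep)
        (sub_mem (Submodule.smul_mem _ _ (aux_self _ _).1) (Submodule.smul_mem _ _ c1PQ)) (by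
          have : p • P₁.rep - c • C₁.rep = c' • C₂.rep - p' • P₂.rep := by
            linear_combination (norm := module) hp - hc
          rw [this]
          exact sub_mem (Submodule.smul_mem _ _ c2PQ) (Submodule.smul_mem _ _ (aux_self _ _).1))
      obtain ⟨m, hm⟩ := iSR (r • R₁.rep - c • C₁.rep)
        (sub_mem (Submodule.smul_mem _ _ (aux_self _ _).2) (Submodule.smul_mem _ _ c1SR)) (by
          have : r • R₁.rep - c • C₁.rep = c' • C₂.rep - r' • R₂.rep := by
            linear_combination (norm := module) hr - hc
          rw [this]
          exact sub_mem (Submodule.smul_mem _ _ c2SR) (Submodule.smul_mem _ _ (aux_self _ _).2))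
      have hm0 : m ≠ 0 := by
        rintro rfl
        obtain ⟨e1, e2, e3⟩ := tri (p - k * p) (k * q) (-r) (by
          linear_combination (norm := module) hk - hm)
        have hr0 : r = 0 := neg_eq_zero.1 e3
        rcases mul_eq_zero.1 e2 with h | h
        · rw [h] at e1
          exact zPR (by simpa using e1) hr0
        · exact zQR h hr0
      have h5 : m • (s • S₁.rep - r • R₁.rep) =
        (k - 1) • (p • P₁.rep - q • Q₁.rep) + (-1 : K) • (q • Q₁.rep - r • R₁.rep) := by
        linear_combination (norm := module) hk - hm
      refine ⟨m⁻¹ * (k - 1), m⁻¹ * (-1), ?_⟩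
      rw [mul_smul, mul_smul, ← smul_add, ← h5, smul_smul, inv_mul_cancel₀ hm0, one_smul]
  obtain ⟨u, v, huv⟩ := key
  have hli : LinearIndependent K ![p • P₁.rep - q • Q₁.rep, q • Q₁.rep - r • R₁.rep] := by
    rw [LinearIndependent.pair_iff]
    intro a b h
    obtain ⟨e1, e2, e3⟩ := tri (a * p) (b * q - a * q) (-(b * r)) (by
      linear_combination (norm := module) h)
    grind
  refine ⟨Submodule.span K {p • P₁.rep - q • Q₁.rep, q • Q₁.rep - r • R₁.rep}, ?_, ?_⟩
  · have := finrank_span_eq_card hli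
    rw [Matrix.range_cons_cons_empty] at this
    simpa using this
  have fin : ∀ (L M : Submodule K (Fin 3 → K)) (X : Fin 3 → K),
      (∀ y, y ∈ L → y ∈ M → ∃ k : K, y = k • X) →
      (∃ a b : K, a • (p • P₁.rep - q • Q₁.rep) + b • (q • Q₁.rep - r • R₁.rep) = X) →
      ∀ x : Projectivization K (Fin 3 → K), x.submodule ≤ L → x.submodule ≤ M →
      x.submodule ≤
        Submodule.span K {p • P₁.rep - q • Q₁.rep, q • Q₁.rep - r • R₁.rep} := by
    intro L M X h1 h2 x hx hx'
    rw [aux_le] at *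
    obtain ⟨k, hk⟩ := h1 _ hx hx'
    rw [hk]
    exact Submodule.smul_mem _ _ (Submodule.mem_span_pair.2 h2)
  exact ⟨fin _ _ _ iQR ⟨0, 1, by module⟩, fin _ _ _ iRP ⟨-1, -1, by module⟩,
    fin _ _ _ iPQ ⟨1, 0, by module⟩,
    fin _ _ _ iSP ⟨u - 1, v - 1, by linear_combination (norm := module) -huv⟩,
    fin _ _ _ iSQ ⟨u, v - 1, by linear_combination (norm := module) -huv⟩,
    fin _ _ _ iSR ⟨u, v, huv.symm⟩⟩
end
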